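/- arXiv:1601.00479 — 2 statements merged into one kernel-verified Lean document; each statement's English description precedes it below -/
import Mathlib

section
/- Let G be a task graph with n vertices and let β ∈ (0,1) be a bias factor. If G has a motivating subgraph for reward r ≥ 0 and bias β, then there exists a directed path from s to t in G such that the subgraph of G consisting of exactly the edges of this path is motivating for reward (1 + β·n)·r and bias β. -/
open scoped ENNReal

/-- A task graph: a finite directed acyclic graph with nonnegative real edge
costs, a source `s` and a target `t`. -/
structure TaskGraph (V : Type) [Fintype V] where
  E : V → V → Prop
  cost : V → V → ℝ
  s : V
  t : V
  cost_nonneg : ∀ v w, 0 ≤ cost v w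
  acyclic : ∀ (v : V) (l : List V),
    l.Chain' E → l.head? = some v → l.getLast? = some v → l.length ≤ 1

namespace TaskGraph

variable {V : Type} [Fintype V]

/-- `l` is the list of vertices of a directed path from `u` to `v` in `G`. -/
def IsPathFrom (G : TaskGraph V) (u v : V) (l : List V) : Prop :=
  l ≠ [] ∧ l.head? = some u ∧ l.getLast? = some v ∧ l.Chain' G.E

/-- Total edge cost of a path, given as the list of its vertices. -/
def pathCost (G : TaskGraph V) (l : List V) : ℝ :=
  (List.zipWith G.cost l l.tail).sum

/-- `d_G(v)`: minimum total edge cost of a directed path from `v` to `t`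
(`∞` if no such path exists). -/
noncomputable def dist (G : TaskGraph V) (v : V) : ℝ≥0∞ :=
  sInf {x | ∃ l, G.IsPathFrom v G.t l ∧ x = ENNReal.ofReal (G.pathCost l)}

/-- `ζ_G(v)`: the agent's lowest perceived cost at `v` for bias factor `β`
(`∞` if `v` has no outgoing edge). -/
noncomputable def zeta (G : TaskGraph V) (β : ℝ) (v : V) : ℝ≥0∞ :=
  sInf {x | ∃ w, G.E v w ∧
    x = ENNReal.ofReal (G.cost v w) + ENNReal.ofReal β * G.dist w}

/-- One step of the agent for reward `r` placed at `t` and bias `β`. -/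
def step (G : TaskGraph V) (β r : ℝ) (v w : V) : Prop :=
  v ≠ G.t ∧ G.zeta β v ≤ ENNReal.ofReal (β * r) ∧ G.E v w ∧
    ENNReal.ofReal (G.cost v w) + ENNReal.ofReal β * G.dist w = G.zeta β v

/-- An agent walk: a maximal sequence of steps starting at `s`.  The walk stops
at its last vertex `v` only if `v = t`, or `ζ_G(v) > β·r` (which includes the
case that `v` has no outgoing edge, where `ζ_G(v) = ∞`). -/
def AgentWalk (G : TaskGraph V) (β r : ℝ) (l : List V) : Prop :=
  l.head? = some G.s ∧ l.Chain' (G.step β r) ∧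
    ∀ v, l.getLast? = some v →
      v = G.t ∨ ¬ G.zeta β v ≤ ENNReal.ofReal (β * r)

/-- `G` is motivating for reward `r` and bias `β` if every agent walk ends at `t`. -/
def Motivating (G : TaskGraph V) (β r : ℝ) : Prop :=
  ∀ l, G.AgentWalk β r l → l.getLast? = some G.t

/-- `G'` is a subgraph of `G`: same vertices, source, target and costs, and a
subset of the edges. -/
def Subgraph (G' G : TaskGraph V) : Prop :=
  G'.s = G.s ∧ G'.t = G.t ∧ G'.cost = G.cost ∧ ∀ v w, G'.E v w → G.E v w

/-- `(v, w)` is an edge of the path with vertex list `l`. -/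
def edgeOfPath (l : List V) (v w : V) : Prop :=
  (v, w) ∈ List.zip l l.tail

/-- `G'` is the subgraph of `G` consisting of exactly the edges of the path `l`. -/
def IsPathSubgraph (G' G : TaskGraph V) (l : List V) : Prop :=
  G'.s = G.s ∧ G'.t = G.t ∧ G'.cost = G.cost ∧
    ∀ v w, G'.E v w ↔ edgeOfPath l v w

end TaskGraph

namespace TaskGraph

theorem isChain_edgeOfPath {V : Type} (l : List V) : l.IsChain (edgeOfPath l) := by
  rw [List.isChain_iff_getElem]
  intro i hi
  rw [edgeOfPath, List.mem_iff_getElem]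
  exact ⟨i, by simp; omega, by simp⟩

theorem mem_of_edgeOfPath {V : Type} {l : List V} {v w : V} (h : edgeOfPath l v w) : w ∈ l :=
  List.mem_of_mem_tail (List.of_mem_zip h).2

variable {V : Type} [Fintype V]

theorem nodup_of_isChain (G : TaskGraph V) {l : List V} (h : l.IsChain G.E) : l.Nodup := by
  induction l with
  | nil => exact List.nodup_nil
  | cons a l ih =>
    refine List.nodup_cons.2 ⟨fun ha => ?_, ih h.tail⟩
    obtain ⟨p, q, rfl⟩ := List.append_of_mem ha
    have hc : (a :: p ++ [a]).IsChain G.E := h.infix ⟨[], q, by simp⟩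
    have := G.acyclic a _ hc (by simp) List.getLast?_concat
    simp at this

theorem length_le_card_of_isChain (G : TaskGraph V) {l : List V} (h : l.IsChain G.E) :
    l.length ≤ Fintype.card V :=
  (G.nodup_of_isChain h).length_le_card

theorem isChain_E_of_isChain_step (G : TaskGraph V) {β r : ℝ} {l : List V}
    (h : l.IsChain (G.step β r)) : l.IsChain G.E :=
  h.imp fun _ _ hs => hs.2.2.1

theorem exists_step (G : TaskGraph V) {β r : ℝ} {v : V} (hv : v ≠ G.t)
    (hz : G.zeta β v ≤ ENNReal.ofReal (β * r)) : ∃ w, G.step β r v w := by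
  have hfin : {x | ∃ w, G.E v w ∧
      x = ENNReal.ofReal (G.cost v w) + ENNReal.ofReal β * G.dist w}.Finite :=
    (Set.finite_range fun w =>
      ENNReal.ofReal (G.cost v w) + ENNReal.ofReal β * G.dist w).subset
      (by rintro x ⟨w, -, rfl⟩; exact ⟨w, rfl⟩)
  have hne : {x | ∃ w, G.E v w ∧
      x = ENNReal.ofReal (G.cost v w) + ENNReal.ofReal β * G.dist w}.Nonempty := by
    by_contra hempty
    rw [Set.not_nonempty_iff_eq_empty] at hempty
    rw [zeta, hempty, sInf_empty] at hz
    exact absurd hz (not_le.2 ENNReal.ofReal_lt_top)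
  obtain ⟨w, hw, hx⟩ := hne.csInf_mem hfin
  exact ⟨w, hv, hz, hw, hx.symm⟩

theorem exists_agentWalk (G : TaskGraph V) (β r : ℝ) : ∃ l, G.AgentWalk β r l := by
  classical
  let P : ℕ → Prop := fun n =>
    ∃ l : List V, l.length = n ∧ l.head? = some G.s ∧ l.IsChain (G.step β r)
  have hP : P 1 := ⟨[G.s], by simp⟩
  have hb : ∀ l : List V, l.IsChain (G.step β r) → l.length ≤ Fintype.card V := fun l hl =>
    G.length_le_card_of_isChain (G.isChain_E_of_isChain_step hl)
  have h1 : 1 ≤ Fintype.card V := hb [G.s] (by simp)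
  obtain ⟨l, hlen, hhead, hchain⟩ := Nat.findGreatest_spec h1 hP
  refine ⟨l, hhead, hchain, fun v hv => ?_⟩
  by_contra! hcon
  obtain ⟨w, hw⟩ := G.exists_step hcon.1 hcon.2
  have hchain' : (l ++ [w]).IsChain (G.step β r) := by
    refine hchain.append (by simp) ?_
    intro x hx y hy
    rw [hv] at hx
    simp only [List.head?_cons, Option.mem_def, Option.some.injEq] at hx hy
    subst hx hy
    exact hw
  have hle := Nat.le_findGreatest (P := P) (hb _ hchain')
    ⟨l ++ [w], rfl, by simp [List.head?_append, hhead], hchain'⟩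
  simp [hlen] at hle

theorem dist_le_pathCost (G : TaskGraph V) {v : V} {l : List V} (h : G.IsPathFrom v G.t l) :
    G.dist v ≤ ENNReal.ofReal (G.pathCost l) :=
  sInf_le ⟨l, h, rfl⟩

theorem zeta_le (G : TaskGraph V) (β : ℝ) {v w : V} (h : G.E v w) :
    G.zeta β v ≤ ENNReal.ofReal (G.cost v w) + ENNReal.ofReal β * G.dist w :=
  sInf_le ⟨w, h, rfl⟩

theorem cost_le_of_step (G : TaskGraph V) {β r : ℝ} (h : 0 ≤ β * r) {v w : V}
    (hs : G.step β r v w) : G.cost v w ≤ β * r := by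
  obtain ⟨-, hz, -, he⟩ := hs
  exact (ENNReal.ofReal_le_ofReal_iff h).1 (le_self_add.trans (he.le.trans hz))

theorem pathCost_le (G : TaskGraph V) {M : ℝ} {a : V} {l : List V}
    (h : (a :: l).IsChain fun v w => G.cost v w ≤ M) :
    G.pathCost (a :: l) ≤ l.length * M := by
  induction l generalizing a with
  | nil => simp [pathCost]
  | cons b l ih =>
    rw [List.isChain_cons_cons] at h
    have := ih h.2
    simp only [pathCost, List.tail_cons, List.zipWith_cons_cons, List.sum_cons,
      List.length_cons, Nat.cast_add, Nat.cast_one] at this ⊢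
    linarith [h.1]

end TaskGraph

/-- If a task graph `G` with `n` vertices has a motivating
subgraph for reward `r ≥ 0` and bias `β ∈ (0,1)`, then there is a directed
path from `s` to `t` in `G` such that the subgraph of `G` consisting of
exactly the edges of this path is motivating for reward `(1 + β·n)·r`. -/
theorem motivating_path_subgraph_beta_n {V : Type} [Fintype V]
    (G : TaskGraph V) (β r : ℝ) (hβ0 : 0 < β) (hβ1 : β < 1) (hr : 0 ≤ r)
    (hmot : ∃ G' : TaskGraph V, G'.Subgraph G ∧ G'.Motivating β r) :
    ∃ l : List V, G.IsPathFrom G.s G.t l ∧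
      ∀ G' : TaskGraph V, G'.IsPathSubgraph G l →
        G'.Motivating β ((1 + β * (Fintype.card V : ℝ)) * r) := by
  obtain ⟨H, ⟨hs, ht, hc, hE⟩, hH⟩ := hmot
  obtain ⟨l, hl⟩ := H.exists_agentWalk β r
  have hlast := hH l hl
  obtain ⟨hhead, hchain, -⟩ := hl
  have hβr : 0 ≤ β * r := by positivity
  have hcard := H.length_le_card_of_isChain (H.isChain_E_of_isChain_step hchain)
  have hcost : l.IsChain fun v w => H.cost v w ≤ β * r :=
    hchain.imp fun _ _ h => H.cost_le_of_step hβr h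
  have hne : l ≠ [] := by rintro rfl; simp at hhead
  refine ⟨l, ⟨hne, hs ▸ hhead, ht ▸ hlast,
    (H.isChain_E_of_isChain_step hchain).imp hE⟩, ?_⟩
  rintro K ⟨hKs, hKt, hKc, hKE⟩ p ⟨hphead, hpchain, hpend⟩
  have hKchain : l.IsChain K.E :=
    (TaskGraph.isChain_edgeOfPath l).imp fun v w h => (hKE v w).2 h
  have hmem : ∀ v ∈ p, v ∈ l := by
    refine hpchain.induction (· ∈ l) p (fun _ _ hst _ =>
      TaskGraph.mem_of_edgeOfPath ((hKE _ _).1 hst.2.2.1)) fun hp => ?_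
    have h1 := List.mem_of_mem_head? hhead
    rw [List.head?_eq_some_head hp, Option.some.injEq] at hphead
    rwa [hphead, hKs, ← hs]
  have hpne : p ≠ [] := by rintro rfl; simp at hphead
  have hpl := List.getLast?_eq_some_getLast hpne
  have hvl := hmem _ (List.getLast_mem hpne)
  generalize p.getLast hpne = v at hpl hvl
  rcases hpend v hpl with rfl | hz
  · exact hpl
  by_contra hvt
  refine hz ?_
  obtain ⟨a, b, rfl⟩ := List.append_of_mem hvl
  cases b with
  | nil =>
    refine absurd ?_ hvt
    simp only [List.getLast?_append, List.getLast?_singleton, Option.some_or] at hlast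
    rw [hpl, hKt, ← ht, hlast]
  | cons w m =>
    have hsuf : (w :: m) <:+ (a ++ v :: w :: m) := ⟨a ++ [v], by simp⟩
    have hvw := (List.isChain_cons_cons.1 (hKchain.suffix ⟨a, rfl⟩)).1
    have hcvw := (List.isChain_cons_cons.1 (hcost.suffix ⟨a, rfl⟩)).1
    have hpath : K.IsPathFrom w K.t (w :: m) := by
      refine ⟨by simp, by simp, ?_, hKchain.suffix hsuf⟩
      rw [hKt, ← ht, ← hlast]
      simp [List.getLast?_append, List.getLast?_cons]
    have hKcost : K.cost = H.cost := hKc.trans hc.symm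
    have hpc : K.pathCost (w :: m) ≤ m.length * (β * r) :=
      K.pathCost_le (by rw [hKcost]; exact hcost.suffix hsuf)
    have hmn : (m.length : ℝ) ≤ Fintype.card V := by
      simp only [List.length_append, List.length_cons] at hcard
      exact_mod_cast (by omega : m.length ≤ Fintype.card V)
    rw [← hKcost] at hcvw
    calc K.zeta β v
        ≤ ENNReal.ofReal (K.cost v w) + ENNReal.ofReal β * K.dist w := K.zeta_le β hvw
      _ ≤ ENNReal.ofReal (β * r) +
            ENNReal.ofReal β * ENNReal.ofReal (Fintype.card V * (β * r)) := by
          gcongr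
          refine (K.dist_le_pathCost hpath).trans (ENNReal.ofReal_le_ofReal (hpc.trans ?_))
          gcongr
      _ = ENNReal.ofReal (β * ((1 + β * (Fintype.card V : ℝ)) * r)) := by
          rw [← ENNReal.ofReal_mul hβ0.le, ← ENNReal.ofReal_add hβr (by positivity)]
          congr 1
          ring
end

section
/- Let G be a task graph containing at least one directed path from s to t, let β ∈ (0,1] and r ≥ 0, and let c* denote the minmax value of G, i.e. the minimum over all directed s–t paths P in G of the maximum edge cost appearing on P. If some subgraph of G is motivating for reward r and bias β, then β·r ≥ c*. -/
open scoped ENNReal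

/-- The maximum edge cost appearing on the path with vertex list `l`
(`0` for a path with no edges). -/
noncomputable def TaskGraph.maxEdgeCost {V : Type} [Fintype V]
    (G : TaskGraph V) (l : List V) : ℝ :=
  (List.zipWith G.cost l l.tail).foldr max 0

namespace TaskGraph

variable {V : Type} [Fintype V]

theorem not_transGen_self (G : TaskGraph V) (v : V) : ¬ Relation.TransGen G.E v v := by
  intro h
  obtain ⟨w, hvw, hwv⟩ := Relation.TransGen.head'_iff.mp h
  obtain ⟨l, hl, hlast⟩ := List.exists_isChain_cons_of_relationReflTransGen hwv
  have := G.acyclic v (v :: w :: l) (List.isChain_cons_cons.mpr ⟨hvw, hl⟩) rfl (by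
    rw [List.getLast?_cons_cons, List.getLast?_eq_some_getLast (List.cons_ne_nil _ _), hlast])
  simp at this

theorem wellFounded_flip_E (G : TaskGraph V) : WellFounded (flip G.E) := by
  let R : V → V → Prop := fun a b => Relation.TransGen G.E b a
  have : IsTrans V R := ⟨fun _ _ _ hab hbc => hbc.trans hab⟩
  have : Std.Irrefl R := ⟨G.not_transGen_self⟩
  have hsub : Subrelation (flip G.E) R := fun h => Relation.TransGen.single h
  exact hsub.wf (Finite.wellFounded_of_trans_of_irrefl R)

/-- From every vertex the agent has a maximal sequence of steps. -/
theorem exists_maximal_steps (G : TaskGraph V) (β r : ℝ) (v : V) :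
    ∃ l : List V, (v :: l).IsChain (G.step β r) ∧
      ∀ u, (v :: l).getLast? = some u →
        u = G.t ∨ ¬ G.zeta β u ≤ ENNReal.ofReal (β * r) := by
  induction v using G.wellFounded_flip_E.induction with
  | _ v ih =>
    by_cases h : v = G.t ∨ ¬ G.zeta β v ≤ ENNReal.ofReal (β * r)
    · refine ⟨[], List.isChain_singleton v, fun u hu => ?_⟩
      obtain rfl : v = u := by simpa using hu
      exact h
    · push Not at h
      obtain ⟨w, hw⟩ := G.exists_step h.1 h.2
      obtain ⟨l, hl, hlast⟩ := ih w hw.2.2.1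
      exact ⟨w :: l, List.isChain_cons_cons.mpr ⟨hw, hl⟩,
        fun u hu => hlast u (by rwa [List.getLast?_cons_cons] at hu)⟩

theorem step.cost_le {G : TaskGraph V} {β r : ℝ} {v w : V} (h : G.step β r v w)
    (hβr : 0 ≤ β * r) : G.cost v w ≤ β * r := by
  obtain ⟨-, hz, -, hzw⟩ := h
  exact (ENNReal.ofReal_le_ofReal_iff hβr).mp
    ((le_self_add.trans hzw.le).trans hz)

theorem maxEdgeCost_nonneg (G : TaskGraph V) (l : List V) : 0 ≤ G.maxEdgeCost l := by
  unfold maxEdgeCost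
  induction List.zipWith G.cost l l.tail with
  | nil => exact le_rfl
  | cons a l ih => exact le_max_of_le_right ih

theorem maxEdgeCost_le (G : TaskGraph V) {C : ℝ} (hC : 0 ≤ C) {l : List V}
    (hl : l.IsChain fun v w => G.cost v w ≤ C) : G.maxEdgeCost l ≤ C := by
  induction hl with
  | nil => exact hC
  | singleton => exact hC
  | cons_cons h _ ih => exact max_le h ih

end TaskGraph

/-- If `G` contains an `s`–`t` path and some subgraph of `G`
is motivating for reward `r ≥ 0` and bias `β ∈ (0,1]`, then `β·r` is at least
the minmax value `c*` of `G`, the minimum over all `s`–`t` paths of the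
maximum edge cost on the path. -/
theorem beta_r_ge_minmax {V : Type} [Fintype V]
    (G : TaskGraph V) (β r : ℝ) (hβ0 : 0 < β) (hβ1 : β ≤ 1) (hr : 0 ≤ r)
    (hpath : ∃ l : List V, G.IsPathFrom G.s G.t l)
    (hmot : ∃ G' : TaskGraph V, G'.Subgraph G ∧ G'.Motivating β r) :
    sInf {x : ℝ | ∃ l : List V, G.IsPathFrom G.s G.t l ∧ x = G.maxEdgeCost l}
      ≤ β * r := by
  obtain ⟨G', ⟨hs, ht, hc, hE⟩, hmot⟩ := hmot
  have hβr : 0 ≤ β * r := mul_nonneg hβ0.le hr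
  obtain ⟨l, hl⟩ := G'.exists_agentWalk β r
  have hlast := hmot l hl
  obtain ⟨hhead, hchain, -⟩ := hl
  have hsteps : l.IsChain (G'.step β r) := hchain
  have hP : G.IsPathFrom G.s G.t l :=
    ⟨by rintro rfl; simp at hhead, hs ▸ hhead, ht ▸ hlast,
      hsteps.imp fun v w h => hE v w h.2.2.1⟩
  have hle : G.maxEdgeCost l ≤ β * r :=
    G.maxEdgeCost_le hβr (hsteps.imp fun v w h => hc ▸ h.cost_le hβr)
  refine csInf_le_of_le ⟨0, ?_⟩ ⟨l, hP, rfl⟩ hle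
  rintro x ⟨l, -, rfl⟩
  exact G.maxEdgeCost_nonneg l
end
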